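/- Let 𝔸 be a homogeneous structure over a relational first-order language, with carrier A. Then the topological closure, in the space A → A with the topology of pointwise convergence over discrete A, of the set of automorphisms of 𝔸 (regarded as functions) equals the set of self-embeddings of 𝔸; moreover, a self-embedding of 𝔸 is an automorphism if and only if it is bijective. -/

import Mathlib

/-- A relational structure on carrier `A`, with relation symbols indexed by
`ι`, symbol `i` having arity `ar i` and interpretation `R i`, is homogeneous
if every isomorphism between finite (induced) substructures extends to an
automorphism. -/
def IsHomogeneous {A ι : Type*} (ar : ι → ℕ) (R : ∀ i, Set (Fin (ar i) → A)) : Prop :=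
  ∀ S : Set A, S.Finite → ∀ f : A → A, Set.InjOn f S →
    (∀ (i : ι) (x : Fin (ar i) → A), (∀ k, x k ∈ S) →
      (x ∈ R i ↔ (fun k => f (x k)) ∈ R i)) →
    ∃ g : A ≃ A,
      (∀ (i : ι) (x : Fin (ar i) → A), x ∈ R i ↔ (fun k => g (x k)) ∈ R i) ∧
      ∀ a ∈ S, g a = f a

/-- The uniformity of pointwise convergence on `I → X` over discrete `X`. -/
noncomputable def funUnif (I X : Type*) : UniformSpace (I → X) :=
  @Pi.uniformSpace I (fun _ => X) (fun _ => ⊥)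

/-- The topology of pointwise convergence on `I → X` over discrete `X`. -/
noncomputable def funTop (I X : Type*) : TopologicalSpace (I → X) :=
  (funUnif I X).toTopologicalSpace

/-- Topological closure w.r.t. the topology of pointwise convergence. -/
def fClosure {I X : Type*} (S : Set (I → X)) : Set (I → X) :=
  @closure _ (funTop I X) S

/-- The automorphisms of a relational structure, regarded as a set of
functions: the bijective maps preserving and reflecting all relations. -/
def autSet {A ι : Type*} (ar : ι → ℕ) (R : ∀ i, Set (Fin (ar i) → A)) :
    Set (A → A) :=
  {f | Function.Bijective f ∧
    ∀ (i : ι) (x : Fin (ar i) → A), x ∈ R i ↔ (fun k => f (x k)) ∈ R i}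

/-- The self-embeddings of a relational structure: the injective maps
preserving and reflecting all relations. -/
def embSet {A ι : Type*} (ar : ι → ℕ) (R : ∀ i, Set (Fin (ar i) → A)) :
    Set (A → A) :=
  {f | Function.Injective f ∧
    ∀ (i : ι) (x : Fin (ar i) → A), x ∈ R i ↔ (fun k => f (x k)) ∈ R i}

/-- A function lies in the closure of `S` iff it agrees with a member of `S` on
every finite set. -/
theorem mem_fClosure_iff {I X : Type*} {S : Set (I → X)} {f : I → X} :
    f ∈ fClosure S ↔ ∀ F : Set I, F.Finite → ∃ g ∈ S, ∀ a ∈ F, g a = f a := by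
  let _ : TopologicalSpace X := ⊥
  have _ : DiscreteTopology X := ⟨rfl⟩
  change f ∈ closure S ↔ _
  rw [mem_closure_iff]
  constructor
  · intro h F hF
    obtain ⟨g, hg, hgS⟩ := h (F.pi fun a => {f a})
      (isOpen_set_pi hF fun _ _ => isOpen_discrete _) fun _ _ => rfl
    exact ⟨g, hgS, hg⟩
  · intro h U hU hfU
    obtain ⟨F, u, hu, hFU⟩ := isOpen_pi_iff.1 hU f hfU
    obtain ⟨g, hgS, hg⟩ := h F F.finite_toSet
    refine ⟨g, hFU fun a ha => ?_, hgS⟩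
    rw [hg a ha]
    exact (hu a ha).2

/-- For a homogeneous relational structure, the closure of
the set of automorphisms (in the topology of pointwise convergence) is the
set of self-embeddings, and a self-embedding is an automorphism iff it is
bijective. -/
theorem closure_autSet_eq_embSet
    {A ι : Type*} (ar : ι → ℕ) (R : ∀ i, Set (Fin (ar i) → A))
    (hhom : IsHomogeneous ar R) :
    fClosure (autSet ar R) = embSet ar R ∧
    ∀ f ∈ embSet ar R, (f ∈ autSet ar R ↔ Function.Bijective f) := by
  refine ⟨Set.ext fun f => ?_, fun f hf => ⟨fun h => h.1, fun h => ⟨h, hf.2⟩⟩⟩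
  rw [mem_fClosure_iff]
  constructor
  · intro h
    refine ⟨fun a b hab => ?_, fun i x => ?_⟩
    · obtain ⟨g, hg, hgf⟩ := h {a, b} (Set.toFinite _)
      apply hg.1.injective
      rw [hgf a (by simp), hgf b (by simp), hab]
    · obtain ⟨g, hg, hgf⟩ := h (Set.range x) (Set.finite_range x)
      have hgx : (fun k => g (x k)) = fun k => f (x k) :=
        funext fun k => hgf (x k) ⟨k, rfl⟩
      rw [← hgx]
      exact hg.2 i x
  · intro hf F hF
    obtain ⟨g, hg, hgf⟩ := hhom F hF f hf.1.injOn fun i x _ => hf.2 i x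
    exact ⟨g, ⟨g.bijective, hg⟩, hgf⟩
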